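/- Let Q ⊆ ℤ^d be a sharp affine semigroup generating ℤ^d as a group. For every subset T ⊆ Q such that (T − Q) ∩ Q ⊆ T (equivalently, Q ∖ T is closed under addition of elements of Q, i.e., T is the set of standard monomial exponents of a monomial ideal of k[Q]), there exist finitely many pairs (α_1, F_1), …, (α_r, F_r) of degrees α_j ∈ ℤ^d and faces F_j of Q such that T = ⋃_{j=1}^{r} Q ∩ (α_j + F_j − Q). (This is the combinatorial content of the existence of a finite irreducible hull/irreducible decomposition for the monomial quotient k[Q]/k{Q ∖ T}.) -/

import Mathlib

open Pointwise

/-- `F` is a face of the affine semigroup (given as a subset of `ℤ^d`) `Q`: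
it is cut out of `Q` by a `ℤ`-linear functional that is nonnegative on `Q`. -/
def IsFaceOf {d : ℕ} (Q F : Set (Fin d → ℤ)) : Prop :=
  ∃ lam : (Fin d → ℤ) →ₗ[ℤ] ℤ, (∀ q ∈ Q, 0 ≤ lam q) ∧ F = {q | q ∈ Q ∧ lam q = 0}

/-- Integral Farkas lemma. -/
theorem farkas_aux {d : ℕ} (n : ℕ) : ∀ (l : List (Fin d → ℤ)) (_ : l.length = n) (b : Fin d → ℤ)
    (_ : ∀ x : Fin d → ℤ, (∀ a ∈ l, 0 ≤ a ⬝ᵥ x) → 0 ≤ b ⬝ᵥ x),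
    ∃ k : ℕ, 0 < k ∧ k • b ∈ AddSubmonoid.closure {a | a ∈ l} := by
  induction n with
  | zero =>
    intro l hl b h
    have hl' : l = [] := List.length_eq_zero_iff.mp hl
    subst hl'
    have h1 := h (-b) (by simp)
    rw [dotProduct_neg] at h1
    have h2 : 0 ≤ b ⬝ᵥ b := by
      unfold dotProduct
      exact Finset.sum_nonneg fun i _ => mul_self_nonneg _
    have h3 : b = 0 := dotProduct_self_eq_zero.mp (by omega)
    exact ⟨1, one_pos, by simp [h3]⟩
  | succ n ih =>
    intro l hl b h
    obtain ⟨a, l, rfl⟩ := List.exists_cons_of_length_eq_add_one hl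
    have hl' : l.length = n := by simpa using hl
    have hmono : AddSubmonoid.closure {c | c ∈ l} ≤ AddSubmonoid.closure {c | c ∈ a :: l} :=
      AddSubmonoid.closure_mono fun c hc => List.mem_cons_of_mem _ hc
    have ha : a ∈ AddSubmonoid.closure {c | c ∈ a :: l} :=
      AddSubmonoid.subset_closure (by simp)
    by_cases hb : ∀ x : Fin d → ℤ, (∀ c ∈ l, 0 ≤ c ⬝ᵥ x) → 0 ≤ b ⬝ᵥ x
    · obtain ⟨k, hk, hm⟩ := ih l hl' b hb
      exact ⟨k, hk, hmono hm⟩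
    · push Not at hb
      obtain ⟨x0, hx0, hbx⟩ := hb
      have hax : a ⬝ᵥ x0 < 0 := by
        by_contra hc
        push Not at hc
        have := h x0 (by
          intro c hc'
          rcases List.mem_cons.mp hc' with rfl | hc'
          · exact hc
          · exact hx0 c hc')
        omega
      obtain ⟨m, hm⟩ : ∃ m : ℕ, (m : ℤ) = -(a ⬝ᵥ x0) := ⟨(-(a ⬝ᵥ x0)).toNat, by omega⟩
      obtain ⟨s, hs⟩ : ∃ s : ℕ, (s : ℤ) = -(b ⬝ᵥ x0) := ⟨(-(b ⬝ᵥ x0)).toNat, by omega⟩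
      have hm0 : 0 < m := by omega
      have key : ∀ (c x : Fin d → ℤ), ((m : ℤ) • c + (c ⬝ᵥ x0) • a) ⬝ᵥ x
          = c ⬝ᵥ ((m : ℤ) • x + (a ⬝ᵥ x) • x0) := by
        intro c x
        simp only [add_dotProduct, dotProduct_add, smul_dotProduct, dotProduct_smul, smul_eq_mul]
        ring
      obtain ⟨k, hk, hmem⟩ := ih (l.map fun c => (m : ℤ) • c + (c ⬝ᵥ x0) • a) (by simpa using hl')
        ((m : ℤ) • b + (b ⬝ᵥ x0) • a) (by
          intro x hx
          rw [key]
          apply h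
          intro c hc
          rcases List.mem_cons.mp hc with rfl | hc
          · rw [← key]
            simp only [add_dotProduct, smul_dotProduct, smul_eq_mul]
            rw [hm]
            apply le_of_eq
            ring
          · rw [← key]
            exact hx _ (List.mem_map_of_mem hc))
      have hle : AddSubmonoid.closure {c | c ∈ l.map fun c => (m : ℤ) • c + (c ⬝ᵥ x0) • a}
          ≤ AddSubmonoid.closure {c | c ∈ a :: l} := by
        rw [AddSubmonoid.closure_le]
        intro c hc
        obtain ⟨c, hcl, rfl⟩ := List.mem_map.mp hc
        obtain ⟨t, ht⟩ : ∃ t : ℕ, (t : ℤ) = c ⬝ᵥ x0 :=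
          ⟨(c ⬝ᵥ x0).toNat, by have := hx0 c hcl; omega⟩
        simp only [← ht, natCast_zsmul]
        exact add_mem (nsmul_mem (AddSubmonoid.subset_closure (by simp [hcl])) _) (nsmul_mem ha _)
      refine ⟨k * m, by positivity, ?_⟩
      have h1 := add_mem (hle hmem) (nsmul_mem ha (k * s))
      convert h1 using 1
      have hs' : b ⬝ᵥ x0 = -(s : ℤ) := by omega
      rw [hs']
      module

theorem face_lemma {d : ℕ} (S : Finset (Fin d → ℤ)) (f : Fin d → ℤ)
    (hf : f ∈ AddSubmonoid.closure (S : Set (Fin d → ℤ))) :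
    IsFaceOf (AddSubmonoid.closure (S : Set (Fin d → ℤ)) : Set (Fin d → ℤ))
      {q | q ∈ AddSubmonoid.closure (S : Set (Fin d → ℤ)) ∧
        ∃ N : ℕ, N • f - q ∈ AddSubmonoid.closure (S : Set (Fin d → ℤ))} := by
  set Q := AddSubmonoid.closure (S : Set (Fin d → ℤ)) with hQ
  have nonneg : ∀ x : Fin d → ℤ, (∀ a ∈ S, 0 ≤ a ⬝ᵥ x) → ∀ q ∈ Q, 0 ≤ q ⬝ᵥ x := by
    intro x hx q hq
    induction hq using AddSubmonoid.closure_induction with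
    | mem a ha => exact hx a ha
    | zero => simp
    | add a b _ _ h1 h2 => rw [add_dotProduct]; omega
  have ex : ∀ a ∈ S, ∃ x : Fin d → ℤ, (∀ c ∈ S, 0 ≤ c ⬝ᵥ x) ∧ f ⬝ᵥ x = 0 ∧
      (a ⬝ᵥ x = 0 → ∃ N : ℕ, N • f - a ∈ Q) := by
    intro a ha
    by_cases h : ∃ N : ℕ, N • f - a ∈ Q
    · exact ⟨0, by simp, by simp, fun _ => h⟩
    by_contra hcon
    push Not at hcon
    apply h
    obtain ⟨k, hk, hmem⟩ := farkas_aux _ ((-f) :: S.toList) rfl (-a) (by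
      intro x hx
      have h1 : ∀ c ∈ S, 0 ≤ c ⬝ᵥ x := fun c hc => hx c (by simp [hc])
      have h2 := hx (-f) (by simp)
      have h3 := nonneg x h1 f hf
      rw [neg_dotProduct] at h2
      have h4 := hcon x h1 (by omega)
      rw [neg_dotProduct, h4.1]
      simp)
    have h1 : ∀ z ∈ AddSubmonoid.closure {c | c ∈ (-f) :: S.toList}, ∃ N : ℕ, z + N • f ∈ Q := by
      intro z hz
      induction hz using AddSubmonoid.closure_induction with
      | mem c hc =>
        rcases List.mem_cons.mp hc with rfl | hc
        · exact ⟨1, by simp⟩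
        · exact ⟨0, by simpa using AddSubmonoid.subset_closure (by simpa using hc)⟩
      | zero => exact ⟨0, by simp⟩
      | add u v _ _ h1 h2 =>
        obtain ⟨N1, h1⟩ := h1
        obtain ⟨N2, h2⟩ := h2
        refine ⟨N1 + N2, ?_⟩
        have := add_mem h1 h2
        rwa [add_add_add_comm, ← add_smul] at this
    obtain ⟨N, hN⟩ := h1 _ hmem
    refine ⟨N, ?_⟩
    obtain ⟨k, rfl⟩ : ∃ k', k = k' + 1 := ⟨k - 1, by omega⟩
    have := add_mem hN (nsmul_mem (AddSubmonoid.subset_closure ha : a ∈ Q) k)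
    convert this using 1
    rw [add_smul]
    simp only [smul_neg, one_smul]
    abel
  choose! x hx using ex
  let X : Fin d → ℤ := ∑ a ∈ S, x a
  have hdot : ∀ q : Fin d → ℤ, q ⬝ᵥ X = ∑ a ∈ S, q ⬝ᵥ x a := fun q => dotProduct_sum _ _ _
  have hpos : ∀ q ∈ Q, ∀ a ∈ S, 0 ≤ q ⬝ᵥ x a := fun q hq a ha => nonneg _ (hx a ha).1 q hq
  have hXpos : ∀ q ∈ Q, 0 ≤ q ⬝ᵥ X := fun q hq => by
    rw [hdot]; exact Finset.sum_nonneg (hpos q hq)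
  refine ⟨{ toFun := fun q => q ⬝ᵥ X
            map_add' := fun u v => add_dotProduct _ _ _
            map_smul' := fun c u => smul_dotProduct _ _ _ }, hXpos, ?_⟩
  ext q
  simp only [Set.mem_ofPred_eq, SetLike.mem_coe, LinearMap.coe_mk, AddHom.coe_mk]
  refine and_congr_right fun hq => ?_
  constructor
  · rintro ⟨N, hN⟩
    have h1 := hXpos _ hN
    have h2 : f ⬝ᵥ X = 0 := by
      rw [hdot]; exact Finset.sum_eq_zero fun a ha => (hx a ha).2.1
    rw [sub_dotProduct, smul_dotProduct, h2] at h1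
    have := hXpos q hq
    simp at h1
    omega
  · intro h0
    clear_value X
    induction hq using AddSubmonoid.closure_induction with
    | mem a ha =>
      rw [hdot] at h0
      rw [Finset.sum_eq_zero_iff_of_nonneg (hpos a (AddSubmonoid.subset_closure ha))] at h0
      exact (hx a ha).2.2 (h0 a ha)
    | zero => exact ⟨0, by simp⟩
    | add u v hu hv h1 h2 =>
      rw [add_dotProduct] at h0
      have h3 := hXpos u hu
      have h4 := hXpos v hv
      obtain ⟨N1, h1⟩ := h1 (by omega)
      obtain ⟨N2, h2⟩ := h2 (by omega)
      refine ⟨N1 + N2, ?_⟩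
      have := add_mem h1 h2
      convert this using 1
      rw [add_smul]; abel

theorem lowerSet_wf (σ : Type*) [Finite σ] : WellFoundedLT (LowerSet (σ → ℕ)) := by
  constructor
  rw [RelEmbedding.wellFounded_iff_isEmpty]
  refine ⟨fun g => ?_⟩
  have hlt : ∀ i j, i < j → g j < g i := fun i j hij => g.map_rel_iff.mpr hij
  have hex : ∀ n, ∃ x, x ∈ g n ∧ x ∉ g (n + 1) := fun n => by
    have := hlt n (n + 1) (Nat.lt_succ_self n)
    exact Set.exists_of_ssubset this
  choose x hx hx' using hex
  obtain ⟨i, j, hij, hle⟩ := wellQuasiOrdered_le (α := σ → ℕ) x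
  have h1 : x j ∈ g (i + 1) := by
    rcases eq_or_lt_of_le (Nat.succ_le_of_lt hij) with h | h
    · have := hx j
      rw [← h] at this ⊢
      exact this
    · exact (hlt _ _ h).le (hx j)
  exact hx' i ((g (i + 1)).lower hle h1)

theorem lowerSet_boxes {σ : Type*} [Finite σ] (D : LowerSet (σ → ℕ)) :
    ∃ P : Set ((σ → ℕ) × Set σ), P.Finite ∧
      ∀ x, x ∈ D ↔ ∃ p ∈ P, ∀ i, i ∉ p.2 → x i ≤ p.1 i := by
  classical
  have := lowerSet_wf σ
  have := Fintype.ofFinite σ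
  induction D using WellFoundedLT.induction with
  | ind D ih =>
  by_cases hne : ∃ z, z ∈ D
  swap
  · push Not at hne
    exact ⟨∅, Set.finite_empty, fun x => by simp [hne x]⟩
  by_cases hdir : ∀ x ∈ D, ∀ y ∈ D, ∃ z ∈ D, x ≤ z ∧ y ≤ z
  · have hfin : ∀ s : Finset σ, ∀ w : σ → (σ → ℕ), (∀ i, w i ∈ D) →
        ∃ z ∈ D, ∀ i ∈ s, w i ≤ z := by
      intro s w hw
      induction s using Finset.induction_on with
      | empty => obtain ⟨z, hz⟩ := hne; exact ⟨z, hz, by simp⟩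
      | insert a s _ ih2 =>
        obtain ⟨z, hz, h1⟩ := ih2
        obtain ⟨z', hz', h2, h3⟩ := hdir z hz _ (hw a)
        refine ⟨z', hz', fun i hi => ?_⟩
        rcases Finset.mem_insert.mp hi with rfl | hi
        · exact h3
        · exact (h1 i hi).trans h2
    have hc : ∀ i : σ, ∃ u : ℕ, (∃ y ∈ D, y i = u) ∧
        ((∃ B : ℕ, ∀ y ∈ D, y i ≤ B) → ∀ y ∈ D, y i ≤ u) := by
      intro i
      by_cases hB : ∃ B : ℕ, ∀ y ∈ D, y i ≤ B
      · obtain ⟨B, hB⟩ := hB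
        have hE : ∃ u, u ∈ {u : ℕ | ∃ y ∈ D, y i = u} := by
          obtain ⟨z, hz⟩ := hne; exact ⟨_, z, hz, rfl⟩
        have hbdd : BddAbove {u : ℕ | ∃ y ∈ D, y i = u} :=
          ⟨B, by rintro u ⟨y, hy, rfl⟩; exact hB y hy⟩
        refine ⟨sSup {u : ℕ | ∃ y ∈ D, y i = u}, Nat.sSup_mem hE hbdd, fun _ y hy => ?_⟩
        exact le_csSup hbdd ⟨y, hy, rfl⟩
      · obtain ⟨z, hz⟩ := hne
        exact ⟨z i, ⟨z, hz, rfl⟩, fun h => absurd h hB⟩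
    choose u hu hmax using hc
    refine ⟨{(u, {i | ¬ ∃ B : ℕ, ∀ y ∈ D, y i ≤ B})}, Set.finite_singleton _, fun x => ?_⟩
    simp only [Set.mem_singleton_iff, exists_eq_left, Set.mem_ofPred_eq, not_not]
    constructor
    · intro hx i hi
      exact hmax i hi x hx
    · intro hx
      have : ∀ i, ∃ w ∈ D, x i ≤ w i := by
        intro i
        by_cases hB : ∃ B : ℕ, ∀ y ∈ D, y i ≤ B
        · obtain ⟨y, hy, h⟩ := hu i
          exact ⟨y, hy, h ▸ hx i hB⟩
        · push Not at hB
          obtain ⟨y, hy, h⟩ := hB (x i)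
          exact ⟨y, hy, h.le⟩
      choose w hw hxw using this
      obtain ⟨z, hz, h⟩ := hfin Finset.univ w hw
      exact D.lower (fun i => (hxw i).trans (h i (Finset.mem_univ i) i)) hz
  · push Not at hdir
    obtain ⟨a, ha, b, hb, hab⟩ := hdir
    have mk : ∀ c ∈ D, ∃ E : LowerSet (σ → ℕ), E < D ∧ ∀ x, x ∈ E ↔ x ∈ D ∧ ¬ c ≤ x := by
      intro c hc
      let E : LowerSet (σ → ℕ) := ⟨{x | x ∈ D ∧ ¬ c ≤ x}, fun x y hyx hx =>
        ⟨D.lower hyx hx.1, fun h => hx.2 (h.trans hyx)⟩⟩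
      have hE : ∀ x, x ∈ E ↔ x ∈ D ∧ ¬ c ≤ x := fun x => Iff.rfl
      refine ⟨E, lt_of_le_not_ge (fun x hx => ((hE x).1 hx).1) fun h => ?_, hE⟩
      exact ((hE c).1 (h hc)).2 le_rfl
    obtain ⟨E1, hE1, h1⟩ := mk a ha
    obtain ⟨E2, hE2, h2⟩ := mk b hb
    obtain ⟨P1, hP1, hm1⟩ := ih E1 hE1
    obtain ⟨P2, hP2, hm2⟩ := ih E2 hE2
    refine ⟨P1 ∪ P2, hP1.union hP2, fun x => ?_⟩
    have : x ∈ D ↔ x ∈ E1 ∨ x ∈ E2 := by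
      rw [h1, h2]
      constructor
      · intro hx
        by_cases hax : a ≤ x
        · exact Or.inr ⟨hx, hab x hx hax⟩
        · exact Or.inl ⟨hx, hax⟩
      · rintro (h | h) <;> exact h.1
    rw [this, hm1, hm2]
    constructor
    · rintro (⟨p, hp, h⟩ | ⟨p, hp, h⟩)
      · exact ⟨p, Or.inl hp, h⟩
      · exact ⟨p, Or.inr hp, h⟩
    · rintro ⟨p, hp | hp, h⟩
      · exact Or.inl ⟨p, hp, h⟩
      · exact Or.inr ⟨p, hp, h⟩

/-- finite irreducible decomposition, combinatorial form.
For a sharp affine semigroup `Q` generating `ℤ^d` and any `T ⊆ Q` with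
`(T − Q) ∩ Q ⊆ T`, there are finitely many pairs `(α_j, F_j)` of degrees and faces with
`T = ⋃_j Q ∩ (α_j + F_j − Q)`. -/
theorem stmt8 {d : ℕ} (Q : AddSubmonoid (Fin d → ℤ)) (hfg : Q.FG)
    (hsharp : (Q : Set (Fin d → ℤ)) ∩ (-(Q : Set (Fin d → ℤ))) = {0})
    (hgen : AddSubgroup.closure (Q : Set (Fin d → ℤ)) = ⊤)
    (T : Set (Fin d → ℤ)) (hTQ : T ⊆ (Q : Set (Fin d → ℤ)))
    (hT : (T - (Q : Set (Fin d → ℤ))) ∩ (Q : Set (Fin d → ℤ)) ⊆ T) :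
    ∃ (r : ℕ) (α : Fin r → (Fin d → ℤ)) (F : Fin r → Set (Fin d → ℤ)),
      (∀ j, IsFaceOf (Q : Set (Fin d → ℤ)) (F j)) ∧
      T = ⋃ j, (Q : Set (Fin d → ℤ)) ∩ (α j +ᵥ (F j - (Q : Set (Fin d → ℤ)))) := by
  classical
  obtain ⟨S, hS⟩ := hfg
  let π : (S → ℕ) →+ (Fin d → ℤ) :=
    { toFun := fun x => ∑ i, x i • (i : Fin d → ℤ)
      map_zero' := by simp
      map_add' := fun x y => by simp [add_smul, Finset.sum_add_distrib] }
  have hπ : ∀ x, π x = ∑ i, x i • (i : Fin d → ℤ) := fun x => rfl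
  have hπQ : ∀ x, π x ∈ Q := by
    intro x
    rw [hπ, ← hS]
    exact sum_mem fun i _ => nsmul_mem (AddSubmonoid.subset_closure i.2) _
  have hsurj : ∀ q ∈ Q, ∃ x, π x = q := by
    intro q hq
    rw [← hS] at hq
    have : AddSubmonoid.closure (S : Set (Fin d → ℤ)) ≤ AddMonoidHom.mrange π := by
      rw [AddSubmonoid.closure_le]
      intro a ha
      refine ⟨Pi.single ⟨a, ha⟩ 1, ?_⟩
      rw [hπ, Finset.sum_eq_single ⟨a, ha⟩]
      · simp
      · intro b _ hb
        simp [Pi.single_eq_of_ne hb]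
      · simp
    exact this hq
  clear_value π
  let D : LowerSet (S → ℕ) := ⟨{x | π x ∈ T}, fun x y hyx hx => by
    refine hT ⟨⟨π x, hx, π (x - y), hπQ _, ?_⟩, hπQ _⟩
    change π x - π (x - y) = π y
    rw [sub_eq_iff_eq_add, ← map_add, add_tsub_cancel_of_le hyx]⟩
  have hD : ∀ x, x ∈ D ↔ π x ∈ T := fun x => Iff.rfl
  obtain ⟨P, hP, hbox⟩ := lowerSet_boxes D
  let ind : Set S → (S → ℕ) := fun A i => if i ∈ A then 1 else 0
  obtain ⟨r, g, hg⟩ := hP.fin_param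
  have hg2 : Set.range g = P := hg.2
  refine ⟨r, fun j => π (g j).1,
    fun j => {q | q ∈ Q ∧ ∃ N : ℕ, N • π (ind (g j).2) - q ∈ Q}, fun j => ?_, ?_⟩
  · have := face_lemma S (π (ind (g j).2)) (by rw [hS]; exact hπQ _)
    rwa [hS] at this
  ext t
  simp only [Set.mem_iUnion, Set.mem_inter_iff, SetLike.mem_coe]
  constructor
  · intro ht
    obtain ⟨x, rfl⟩ := hsurj t (hTQ ht)
    obtain ⟨p, hp, hle⟩ := (hbox x).1 ((hD x).2 ht)
    rw [← hg2] at hp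
    obtain ⟨j, rfl⟩ := hp
    refine ⟨j, hπQ _, ?_⟩
    have hle' : x ≤ (g j).1 + (∑ i, x i) • ind (g j).2 := by
      intro i
      have h1 : x i ≤ ∑ i, x i := Finset.single_le_sum (fun _ _ => Nat.zero_le _) (Finset.mem_univ i)
      by_cases hi : i ∈ (g j).2
      · simp only [ind, Pi.add_apply, Pi.smul_apply, hi, if_true, smul_eq_mul, mul_one]
        omega
      · exact (hle i hi).trans (Nat.le_add_right _ _)
    refine ⟨(∑ i, x i) • π (ind (g j).2) - π ((g j).1 + (∑ i, x i) • ind (g j).2 - x),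
      ⟨_, ⟨nsmul_mem (hπQ _) _, (∑ i, x i), by simp⟩, _, hπQ _, rfl⟩, ?_⟩
    have h2 := congrArg π (add_tsub_cancel_of_le hle')
    rw [map_add, map_add, map_nsmul] at h2
    change π (g j).1 + _ = _
    rw [← add_sub_assoc, ← h2]
    abel
  · rintro ⟨j, htQ, y, ⟨q, ⟨hq, N, hN⟩, q', hq', rfl⟩, rfl⟩
    have h1 : π ((g j).1 + N • ind (g j).2) ∈ T := by
      rw [← hD, hbox]
      refine ⟨g j, hg2 ▸ ⟨j, rfl⟩, fun i hi => ?_⟩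
      simp [ind, hi]
    refine hT ⟨⟨_, h1, _, add_mem hN hq', ?_⟩, htQ⟩
    change π ((g j).1 + N • ind (g j).2) - _ = π (g j).1 + (q - q')
    rw [map_add, map_nsmul]
    abel
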